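/- Two linear (read-once) positive Boolean formulas compute the same monotone Boolean function if and only if they are equivalent modulo associativity and commutativity of ∨ and ∧. -/

import Mathlib

namespace BGL

/-- Positive Boolean formulas over variables in `V`. -/
inductive PBF (V : Type*) : Type _
  | var : V → PBF V
  | or  : PBF V → PBF V → PBF V
  | and : PBF V → PBF V → PBF V

namespace PBF

variable {V : Type*} [DecidableEq V]

/-- The (finite) set of variables occurring in a formula. -/
def vars : PBF V → Finset V
  | .var x => {x}
  | .or A B => A.vars ∪ B.vars
  | .and A B => A.vars ∪ B.vars

/-- A formula is linear (read-once) if each variable occurs at most once in it. -/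
def Linear : PBF V → Prop
  | .var _ => True
  | .or A B => A.Linear ∧ B.Linear ∧ Disjoint A.vars B.vars
  | .and A B => A.Linear ∧ B.Linear ∧ Disjoint A.vars B.vars

/-- Evaluation of a formula on an assignment `X ⊆ V`. -/
def eval (X : Set V) : PBF V → Prop
  | .var x => x ∈ X
  | .or A B => A.eval X ∨ B.eval X
  | .and A B => A.eval X ∧ B.eval X

/-- `x` and `y` are distinct variables of `A` whose least common connective is `∧`. -/
def webAdj : PBF V → V → V → Prop
  | .var _, _, _ => False
  | .or A B, x, y => A.webAdj x y ∨ B.webAdj x y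
  | .and A B, x, y => A.webAdj x y ∨ B.webAdj x y ∨
      (x ∈ A.vars ∧ y ∈ B.vars) ∨ (x ∈ B.vars ∧ y ∈ A.vars)

/-- The relation web of a formula: the graph on its variables with an edge between
two variables iff their least common connective is `∧`. -/
def web (A : PBF V) : SimpleGraph V := SimpleGraph.fromRel A.webAdj

/-- Equivalence of formulas modulo associativity and commutativity of `∨` and `∧`:
the smallest congruence containing the AC equations. -/
inductive AC : PBF V → PBF V → Prop
  | refl (A : PBF V) : AC A A
  | symm {A B : PBF V} : AC A B → AC B A
  | trans {A B C : PBF V} : AC A B → AC B C → AC A C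
  | orComm (A B : PBF V) : AC (.or A B) (.or B A)
  | andComm (A B : PBF V) : AC (.and A B) (.and B A)
  | orAssoc (A B C : PBF V) : AC (.or A (.or B C)) (.or (.or A B) C)
  | andAssoc (A B C : PBF V) : AC (.and A (.and B C)) (.and (.and A B) C)
  | orCongr {A A' B B' : PBF V} : AC A A' → AC B B' → AC (.or A B) (.or A' B')
  | andCongr {A A' B B' : PBF V} : AC A A' → AC B B' → AC (.and A B) (.and A' B')

/-- A minterm of `A`: a minimal set of variables on which `A` evaluates to `1`. -/
def Minterm (A : PBF V) (S : Set V) : Prop :=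
  A.eval S ∧ ∀ S' ⊆ S, A.eval S' → S' = S

/-- A maxterm of `A`: a minimal set of variables `T` such that `A` evaluates to `0`
on the complement of `T` within the variables of `A`. -/
def Maxterm (A : PBF V) (T : Set V) : Prop :=
  ¬ A.eval (↑A.vars \ T) ∧ ∀ T' ⊆ T, ¬ A.eval (↑A.vars \ T') → T' = T

end PBF

variable {V : Type*}

/-- A stable (independent) set: pairwise non-adjacent vertices. -/
def IsStable (G : SimpleGraph V) (T : Set V) : Prop :=
  T.Pairwise fun x y => ¬ G.Adj x y

/-- A maximal clique within the vertex set `U`. -/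
def MaxCliqueOn (G : SimpleGraph V) (U S : Set V) : Prop :=
  S ⊆ U ∧ G.IsClique S ∧ ∀ S' : Set V, S' ⊆ U → G.IsClique S' → S ⊆ S' → S' = S

/-- A maximal stable set within the vertex set `U`. -/
def MaxStableOn (G : SimpleGraph V) (U T : Set V) : Prop :=
  T ⊆ U ∧ IsStable G T ∧ ∀ T' : Set V, T' ⊆ U → IsStable G T' → T ⊆ T' → T' = T

namespace PBF

variable {V : Type*}

theorem AC.eval_iff {A B : PBF V} (h : AC A B) (X : Set V) : A.eval X ↔ B.eval X := by
  induction h with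
  | refl => rfl
  | symm _ ih => exact ih.symm
  | trans _ _ ih₁ ih₂ => exact ih₁.trans ih₂
  | orComm => exact or_comm
  | andComm => exact and_comm
  | orAssoc => exact or_assoc.symm
  | andAssoc => exact and_assoc.symm
  | orCongr _ _ ih₁ ih₂ => exact or_congr ih₁ ih₂
  | andCongr _ _ ih₁ ih₂ => exact and_congr ih₁ ih₂

theorem AC.or_or_or_comm (A B C D : PBF V) :
    AC (.or (.or A B) (.or C D)) (.or (.or A C) (.or B D)) :=
  (AC.orAssoc A B (.or C D)).symm.trans <|
    (AC.orCongr (.refl A) <| (AC.orAssoc B C D).trans <|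
      (AC.orCongr (.orComm B C) (.refl D)).trans (AC.orAssoc C B D).symm).trans
    (AC.orAssoc A C (.or B D))

theorem AC.or_left_comm (A B C : PBF V) : AC (.or A (.or B C)) (.or B (.or A C)) :=
  (AC.orAssoc A B C).trans <| (AC.orCongr (.orComm A B) (.refl C)).trans (AC.orAssoc B A C).symm

theorem AC.or_right_comm (A B C : PBF V) : AC (.or (.or A B) C) (.or (.or A C) B) :=
  (AC.orAssoc A B C).symm.trans <| (AC.orCongr (.refl A) (.orComm B C)).trans (AC.orAssoc A C B)

/-- Interchange law for disjunctions in which some disjuncts may be missing. -/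
theorem AC.of_merge {A₁ A₂ B₁ B₂ : PBF V} {o₁₁ o₁₂ o₂₁ o₂₂ : Option (PBF V)}
    (hA₁ : ∃ D ∈ Option.merge .or o₁₁ o₁₂, AC A₁ D)
    (hA₂ : ∃ D ∈ Option.merge .or o₂₁ o₂₂, AC A₂ D)
    (hB₁ : ∃ D ∈ Option.merge .or o₁₁ o₂₁, AC B₁ D)
    (hB₂ : ∃ D ∈ Option.merge .or o₁₂ o₂₂, AC B₂ D) :
    AC (.or A₁ A₂) (.or B₁ B₂) := by
  obtain ⟨D₁, hD₁, hA₁⟩ := hA₁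
  obtain ⟨D₂, hD₂, hA₂⟩ := hA₂
  obtain ⟨E₁, hE₁, hB₁⟩ := hB₁
  obtain ⟨E₂, hE₂, hB₂⟩ := hB₂
  refine (AC.orCongr hA₁ hA₂).trans (AC.trans ?_ (AC.orCongr hB₁ hB₂).symm)
  rcases o₁₁ with _ | a <;> rcases o₁₂ with _ | b <;> rcases o₂₁ with _ | c <;>
    rcases o₂₂ with _ | d <;> simp [Option.merge] at hD₁ hD₂ hE₁ hE₂ <;> subst_vars <;>
    first
    | exact .refl _
    | exact .orComm _ _
    | exact .orAssoc _ _ _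
    | exact (AC.orAssoc _ _ _).symm
    | exact .or_left_comm _ _ _
    | exact .or_right_comm _ _ _
    | exact .or_or_or_comm _ _ _ _

/-- The De Morgan dual of a formula. -/
def dual : PBF V → PBF V
  | .var x => .var x
  | .or A B => .and A.dual B.dual
  | .and A B => .or A.dual B.dual

@[simp]
theorem dual_dual (A : PBF V) : A.dual.dual = A := by
  induction A <;> simp_all [dual]

theorem eval_dual (A : PBF V) (X : Set V) : A.dual.eval X ↔ ¬ A.eval Xᶜ := by
  induction A <;> simp_all [dual, eval] <;> tauto

theorem AC.dual {A B : PBF V} (h : AC A B) : AC A.dual B.dual := by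
  induction h with
  | refl => exact .refl _
  | symm _ ih => exact ih.symm
  | trans _ _ ih₁ ih₂ => exact ih₁.trans ih₂
  | orComm => exact .andComm _ _
  | andComm => exact .orComm _ _
  | orAssoc => exact .andAssoc _ _ _
  | andAssoc => exact .orAssoc _ _ _
  | orCongr _ _ ih₁ ih₂ => exact .andCongr ih₁ ih₂
  | andCongr _ _ ih₁ ih₂ => exact .orCongr ih₁ ih₂

theorem eval_dual_congr {A B : PBF V} (h : ∀ X : Set V, A.eval X ↔ B.eval X) (X : Set V) :
    A.dual.eval X ↔ B.dual.eval X := by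
  rw [eval_dual, eval_dual, h]

theorem eval_mono (A : PBF V) {X Y : Set V} (h : X ⊆ Y) (hX : A.eval X) : A.eval Y := by
  induction A with
  | var x => exact h hX
  | or A B ihA ihB => exact hX.imp ihA ihB
  | and A B ihA ihB => exact hX.imp ihA ihB

variable [DecidableEq V]

@[simp]
theorem vars_dual (A : PBF V) : A.dual.vars = A.vars := by
  induction A <;> simp_all [dual, vars]

theorem Linear.dual {A : PBF V} (h : A.Linear) : A.dual.Linear := by
  induction A <;> simp_all [PBF.dual, Linear]

theorem vars_nonempty (A : PBF V) : A.vars.Nonempty := by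
  induction A <;> simp_all [vars]

theorem eval_inter_vars (A : PBF V) {X : Set V} {s : Finset V} (h : A.vars ⊆ s) :
    A.eval (X ∩ s) ↔ A.eval X := by
  induction A with
  | var x => simp_all [eval, vars]
  | or A B ihA ihB =>
    exact or_congr (ihA (Finset.union_subset_left h)) (ihB (Finset.union_subset_right h))
  | and A B ihA ihB =>
    exact and_congr (ihA (Finset.union_subset_left h)) (ihB (Finset.union_subset_right h))

theorem eval_of_vars_subset (A : PBF V) {X : Set V} (h : ↑A.vars ⊆ X) : A.eval X := by
  induction A <;> simp_all [eval, vars]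

theorem exists_mem_vars_of_eval (A : PBF V) {X : Set V} (h : A.eval X) :
    ∃ x ∈ A.vars, x ∈ X := by
  induction A with
  | var x => exact ⟨x, by simp [vars], h⟩
  | or A B ihA ihB => simp only [eval, vars, Finset.mem_union] at *; grind
  | and A B ihA ihB => simp only [eval, vars, Finset.mem_union] at *; grind

theorem not_eval_inter_of_disjoint (A : PBF V) (X : Set V) {s : Finset V}
    (h : Disjoint A.vars s) : ¬ A.eval (X ∩ s) := fun hA ↦
  have ⟨_, hx, hxs⟩ := A.exists_mem_vars_of_eval hA
  Finset.disjoint_left.mp h hx hxs.2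

/-- A linear formula depends on each of its variables. -/
theorem Linear.exists_critical {A : PBF V} (hA : A.Linear) {x : V} (hx : x ∈ A.vars) :
    ∃ S : Set V, S ⊆ A.vars ∧ A.eval S ∧ ¬ A.eval (S \ {x}) := by
  induction A with
  | var y => exact ⟨{y}, by simp_all [eval, vars]⟩
  | or A B ihA ihB =>
    have aux (C D : PBF V) (hd : Disjoint C.vars D.vars) (S : Set V) (hS : S ⊆ C.vars) :
        ¬ D.eval (S \ {x}) := fun h ↦
      have ⟨y, hy, hyS⟩ := D.exists_mem_vars_of_eval h
      Finset.disjoint_left.mp hd (hS hyS.1) hy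
    obtain ⟨hA, hB, hd⟩ := hA
    rcases Finset.mem_union.mp hx with hx | hx
    · obtain ⟨S, hS, h₁, h₂⟩ := ihA hA hx
      exact ⟨S, hS.trans (by simp [vars]), .inl h₁, not_or.mpr ⟨h₂, aux A B hd S hS⟩⟩
    · obtain ⟨S, hS, h₁, h₂⟩ := ihB hB hx
      exact ⟨S, hS.trans (by simp [vars]), .inr h₁, not_or.mpr ⟨aux B A hd.symm S hS, h₂⟩⟩
  | and A B ihA ihB =>
    have aux (C D : PBF V) (hd : Disjoint C.vars D.vars) (S : Set V)
        (h : ¬ C.eval (S \ {x})) : ¬ C.eval ((S ∪ D.vars) \ {x}) := fun h' ↦ by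
      refine h (C.eval_mono ?_ ((C.eval_inter_vars subset_rfl).mpr h'))
      rintro y ⟨⟨hy | hy, hyx⟩, hyC⟩
      · exact ⟨hy, hyx⟩
      · exact (Finset.disjoint_left.mp hd hyC hy).elim
    obtain ⟨hA, hB, hd⟩ := hA
    rcases Finset.mem_union.mp hx with hx | hx
    · obtain ⟨S, hS, h₁, h₂⟩ := ihA hA hx
      refine ⟨S ∪ B.vars, ?_, ⟨A.eval_mono Set.subset_union_left h₁,
        B.eval_of_vars_subset Set.subset_union_right⟩, fun h ↦ aux A B hd S h₂ h.1⟩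
      simpa [vars] using hS.trans Set.subset_union_left
    · obtain ⟨S, hS, h₁, h₂⟩ := ihB hB hx
      refine ⟨S ∪ A.vars, ?_, ⟨A.eval_of_vars_subset Set.subset_union_right,
        B.eval_mono Set.subset_union_left h₁⟩, fun h ↦ aux B A hd.symm S h₂ h.2⟩
      simpa [vars] using hS.trans Set.subset_union_right

/-- Setting the variables outside `U` to `0` in a linear formula yields a linear formula, or the
constant `0` (represented by `none`). -/
theorem Linear.exists_restrict {A : PBF V} (hA : A.Linear) (U : Finset V) :
    ∃ o : Option (PBF V), (∀ D ∈ o, D.Linear ∧ D.vars ⊆ A.vars ∩ U) ∧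
      ∀ X : Set V, (∃ D ∈ o, D.eval X) ↔ A.eval (X ∩ U) := by
  induction A with
  | var x =>
    by_cases hx : x ∈ U
    · exact ⟨some (.var x), by simp [Linear, vars, eval, hx]⟩
    · exact ⟨none, by simp [eval, hx]⟩
  | or A B ihA ihB =>
    obtain ⟨hA, hB, hd⟩ := hA
    obtain ⟨o₁, h₁, e₁⟩ := ihA hA
    obtain ⟨o₂, h₂, e₂⟩ := ihB hB
    refine ⟨Option.merge .or o₁ o₂, ?_, fun X ↦ ?_⟩
    · rcases o₁ with _ | a <;> rcases o₂ with _ | b <;>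
        simp [Option.merge, Linear, vars] at h₁ h₂ ⊢ <;> grind [Finset.disjoint_left]
    · simp only [eval, ← e₁, ← e₂]
      rcases o₁ with _ | a <;> rcases o₂ with _ | b <;> simp [Option.merge, eval]
  | and A B ihA ihB =>
    obtain ⟨hA, hB, hd⟩ := hA
    obtain ⟨o₁, h₁, e₁⟩ := ihA hA
    obtain ⟨o₂, h₂, e₂⟩ := ihB hB
    refine ⟨Option.map₂ .and o₁ o₂, ?_, fun X ↦ ?_⟩
    · rcases o₁ with _ | a <;> rcases o₂ with _ | b <;>
        simp [Linear, vars] at h₁ h₂ ⊢ <;> grind [Finset.disjoint_left]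
    · simp only [eval, ← e₁, ← e₂]
      rcases o₁ with _ | a <;> rcases o₂ with _ | b <;> simp [eval]

theorem exists_mem_merge_or {A : PBF V} {s t : Finset V} {o₁ o₂ : Option (PBF V)}
    (hst : Disjoint s t)
    (h₁ : ∀ D ∈ o₁, D.Linear ∧ D.vars ⊆ s) (h₂ : ∀ D ∈ o₂, D.Linear ∧ D.vars ⊆ t)
    (h : ∀ X : Set V, A.eval X ↔ (∃ D ∈ o₁, D.eval X) ∨ ∃ D ∈ o₂, D.eval X) :
    ∃ D ∈ Option.merge .or o₁ o₂, D.Linear ∧ D.vars ⊆ s ∪ t ∧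
      ∀ X : Set V, A.eval X ↔ D.eval X := by
  have hA := (h _).mp (A.eval_of_vars_subset subset_rfl)
  rcases o₁ with _ | a <;> rcases o₂ with _ | b <;>
    simp [Option.merge, Linear, vars, eval] at * <;> grind [Finset.disjoint_left]

theorem AC.or_or_of_eval {A₁ A₂ B₁ B₂ : PBF V}
    (hA : (A₁.or A₂).Linear) (hB : (B₁.or B₂).Linear)
    (h : ∀ X : Set V, (A₁.or A₂).eval X ↔ (B₁.or B₂).eval X)
    (ih : ∀ C D : PBF V, C.vars.card + D.vars.card <
      (A₁.or A₂).vars.card + (B₁.or B₂).vars.card → C.Linear → D.Linear →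
      (∀ X : Set V, C.eval X ↔ D.eval X) → AC C D) :
    AC (.or A₁ A₂) (.or B₁ B₂) := by
  obtain ⟨hA₁, hA₂, hdA⟩ := hA
  obtain ⟨hB₁, hB₂, hdB⟩ := hB
  simp only [eval] at h
  obtain ⟨o₁₁, l₁₁, e₁₁⟩ := hB₁.exists_restrict A₁.vars
  obtain ⟨o₁₂, l₁₂, e₁₂⟩ := hB₂.exists_restrict A₁.vars
  obtain ⟨o₂₁, l₂₁, e₂₁⟩ := hB₁.exists_restrict A₂.vars
  obtain ⟨o₂₂, l₂₂, e₂₂⟩ := hB₂.exists_restrict A₂.vars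
  have cA : (A₁.or A₂).vars.card = A₁.vars.card + A₂.vars.card := Finset.card_union_of_disjoint hdA
  have cB : (B₁.or B₂).vars.card = B₁.vars.card + B₂.vars.card := Finset.card_union_of_disjoint hdB
  have pA₁ := A₁.vars_nonempty.card_pos
  have pA₂ := A₂.vars_nonempty.card_pos
  have pB₁ := B₁.vars_nonempty.card_pos
  have pB₂ := B₂.vars_nonempty.card_pos
  have fA₁ (X : Set V) : A₁.eval X ↔ B₁.eval (X ∩ A₁.vars) ∨ B₂.eval (X ∩ A₁.vars) := by
    rw [← h, A₁.eval_inter_vars subset_rfl, or_iff_left (A₂.not_eval_inter_of_disjoint X hdA.symm)]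
  have fA₂ (X : Set V) : A₂.eval X ↔ B₁.eval (X ∩ A₂.vars) ∨ B₂.eval (X ∩ A₂.vars) := by
    rw [← h, A₂.eval_inter_vars subset_rfl, or_iff_right (A₁.not_eval_inter_of_disjoint X hdA)]
  have split (C D : PBF V) (hd : Disjoint C.vars D.vars) (X : Set V)
      (hCD : ∀ Y : Set V, B₁.eval Y ∨ B₂.eval Y ↔ C.eval Y ∨ D.eval Y) :
      C.eval X ↔ C.eval (X ∩ A₁.vars) ∨ C.eval (X ∩ A₂.vars) := by
    have n (Y : Set V) : ¬ D.eval (Y ∩ C.vars) := D.not_eval_inter_of_disjoint _ hd.symm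
    have := h (X ∩ C.vars)
    simpa only [fA₁, fA₂, hCD, Set.inter_right_comm X, n, or_false,
      C.eval_inter_vars subset_rfl, iff_comm] using this
  have fB₁ (X : Set V) := split B₁ B₂ hdB X fun _ ↦ Iff.rfl
  have fB₂ (X : Set V) := split B₂ B₁ hdB.symm X fun _ ↦ or_comm
  simp only [← e₁₁, ← e₁₂, ← e₂₁, ← e₂₂] at fA₁ fA₂ fB₁ fB₂
  have dB (s : Finset V) : Disjoint (B₁.vars ∩ s) (B₂.vars ∩ s) :=
    hdB.mono Finset.inter_subset_left Finset.inter_subset_left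
  have dA (s : Finset V) : Disjoint (s ∩ A₁.vars) (s ∩ A₂.vars) :=
    hdA.mono Finset.inter_subset_right Finset.inter_subset_right
  obtain ⟨D₁, m₁, l₁, v₁, q₁⟩ := exists_mem_merge_or (dB _) l₁₁ l₁₂ fA₁
  obtain ⟨D₂, m₂, l₂, v₂, q₂⟩ := exists_mem_merge_or (dB _) l₂₁ l₂₂ fA₂
  obtain ⟨E₁, m₃, l₃, v₃, q₃⟩ := exists_mem_merge_or (dA _) l₁₁ l₂₁ fB₁
  obtain ⟨E₂, m₄, l₄, v₄, q₄⟩ := exists_mem_merge_or (dA _) l₁₂ l₂₂ fB₂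
  rw [← Finset.union_inter_distrib_right] at v₁ v₂
  rw [← Finset.inter_union_distrib_left] at v₃ v₄
  have c₁ := Finset.card_le_card (v₁.trans Finset.inter_subset_left)
  have c₂ := Finset.card_le_card (v₂.trans Finset.inter_subset_left)
  have c₃ := Finset.card_le_card (v₃.trans Finset.inter_subset_right)
  have c₄ := Finset.card_le_card (v₄.trans Finset.inter_subset_right)
  rw [Finset.card_union_of_disjoint hdB] at c₁ c₂
  rw [Finset.card_union_of_disjoint hdA] at c₃ c₄
  exact .of_merge ⟨D₁, m₁, ih _ _ (by omega) hA₁ l₁ q₁⟩ ⟨D₂, m₂, ih _ _ (by omega) hA₂ l₂ q₂⟩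
    ⟨E₁, m₃, ih _ _ (by omega) hB₁ l₃ q₃⟩ ⟨E₂, m₄, ih _ _ (by omega) hB₂ l₄ q₄⟩

theorem not_forall_eval_or_iff_eval_and {A₁ A₂ B₁ B₂ : PBF V}
    (hA : (A₁.or A₂).Linear) (hB : (B₁.and B₂).Linear) :
    ¬ ∀ X : Set V, (A₁.or A₂).eval X ↔ (B₁.and B₂).eval X := by
  intro h
  obtain ⟨-, -, hdA⟩ := hA
  obtain ⟨hB₁, hB₂, hdB⟩ := hB
  have key (x) (hx : x ∈ B₁.vars) (y) (hy : y ∈ B₂.vars) :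
      (x ∈ A₁.vars ∧ y ∈ A₁.vars) ∨ (x ∈ A₂.vars ∧ y ∈ A₂.vars) := by
    obtain ⟨S, hS, s₁, s₂⟩ := hB₁.exists_critical hx
    obtain ⟨T, hT, t₁, t₂⟩ := hB₂.exists_critical hy
    have nx : ¬ (A₁.or A₂).eval ((S ∪ T) \ {x}) := fun hx' ↦ by
      refine s₂ (B₁.eval_mono ?_ ((B₁.eval_inter_vars subset_rfl).mpr ((h _).mp hx').1))
      rintro z ⟨⟨hz | hz, hzx⟩, hzB⟩
      · exact ⟨hz, hzx⟩
      · exact (Finset.disjoint_left.mp hdB hzB (hT hz)).elim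
    have ny : ¬ (A₁.or A₂).eval ((S ∪ T) \ {y}) := fun hy' ↦ by
      refine t₂ (B₂.eval_mono ?_ ((B₂.eval_inter_vars subset_rfl).mpr ((h _).mp hy').2))
      rintro z ⟨⟨hz | hz, hzy⟩, hzB⟩
      · exact (Finset.disjoint_left.mp hdB (hS hz) hzB).elim
      · exact ⟨hz, hzy⟩
    have mem (C : PBF V) (hC : C.eval (S ∪ T)) (z : V) (hz : ¬ C.eval ((S ∪ T) \ {z})) :
        z ∈ C.vars := by
      by_contra hzC
      refine hz (C.eval_mono ?_ ((C.eval_inter_vars subset_rfl).mpr hC))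
      rintro w ⟨hw, hwC⟩
      exact ⟨hw, fun hwz ↦ hzC (hwz ▸ hwC)⟩
    rcases (h (S ∪ T)).mpr ⟨B₁.eval_mono Set.subset_union_left s₁,
      B₂.eval_mono Set.subset_union_right t₁⟩ with hA | hA
    · exact .inl ⟨mem _ hA x (nx ∘ .inl), mem _ hA y (ny ∘ .inl)⟩
    · exact .inr ⟨mem _ hA x (nx ∘ .inr), mem _ hA y (ny ∘ .inr)⟩
  obtain ⟨x₁, hx₁, hx₁'⟩ := B₁.exists_mem_vars_of_eval
    ((h A₁.vars).mp (.inl (A₁.eval_of_vars_subset subset_rfl))).1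
  obtain ⟨y, hy, hy'⟩ := B₂.exists_mem_vars_of_eval
    ((h A₂.vars).mp (.inr (A₂.eval_of_vars_subset subset_rfl))).2
  have := Finset.disjoint_left.mp hdA
  grind

theorem not_forall_eval_or_iff_mem {A₁ A₂ : PBF V} (hA : (A₁.or A₂).Linear) (x : V) :
    ¬ ∀ X : Set V, (A₁.or A₂).eval X ↔ x ∈ X := fun h ↦
  Finset.disjoint_left.mp hA.2.2
    ((h A₁.vars).mp (.inl (A₁.eval_of_vars_subset subset_rfl)))
    ((h A₂.vars).mp (.inr (A₂.eval_of_vars_subset subset_rfl)))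

theorem AC.of_eval {A B : PBF V} (hA : A.Linear) (hB : B.Linear)
    (h : ∀ X : Set V, A.eval X ↔ B.eval X) : AC A B := by
  induction hn : A.vars.card + B.vars.card using Nat.strong_induction_on generalizing A B with
  | _ n ih =>
    subst hn
    have ih (C D : PBF V) (hlt : C.vars.card + D.vars.card < A.vars.card + B.vars.card)
        (hC : C.Linear) (hD : D.Linear) (hCD : ∀ X : Set V, C.eval X ↔ D.eval X) : AC C D :=
      ih _ hlt hC hD hCD rfl
    match A, B with
    | .var x, .var y =>
      obtain rfl : x = y := (h {y}).mpr rfl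
      exact .refl _
    | .var x, .or B₁ B₂ => exact (not_forall_eval_or_iff_mem hB x fun X ↦ (h X).symm).elim
    | .or A₁ A₂, .var x => exact (not_forall_eval_or_iff_mem hA x h).elim
    | .var x, .and B₁ B₂ =>
      exact (not_forall_eval_or_iff_mem hB.dual x fun X ↦ (eval_dual_congr h X).symm).elim
    | .and A₁ A₂, .var x =>
      exact (not_forall_eval_or_iff_mem hA.dual x (eval_dual_congr h)).elim
    | .or A₁ A₂, .and B₁ B₂ => exact (not_forall_eval_or_iff_eval_and hA hB h).elim
    | .and A₁ A₂, .or B₁ B₂ =>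
      exact (not_forall_eval_or_iff_eval_and hB hA fun X ↦ (h X).symm).elim
    | .or A₁ A₂, .or B₁ B₂ => exact .or_or_of_eval hA hB h ih
    | .and A₁ A₂, .and B₁ B₂ =>
      have := (AC.or_or_of_eval hA.dual hB.dual (eval_dual_congr h) (by simpa [vars] using ih)).dual
      simpa [PBF.dual] using this

end PBF

/-- Linear (read-once) formulas compute the same monotone Boolean function iff
they are equivalent modulo associativity and commutativity. -/
theorem eval_eq_iff_AC {V : Type*} [DecidableEq V]
    (A B : PBF V) (hA : A.Linear) (hB : B.Linear) :
    (∀ X : Set V, A.eval X ↔ B.eval X) ↔ PBF.AC A B := by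
  exact ⟨.of_eval hA hB, PBF.AC.eval_iff⟩

end BGL
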